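/- arXiv:1304.0188 — 3 statements merged into one kernel-verified Lean document; each statement's English description precedes it below -/
import Mathlib

section
/- Assume that there exist a real α with 0 < α < 1 and a real A > 0 such that for all sufficiently large z, #{r ≤ z : r prime and P(r−1) > r^α} ≥ A · z / log z. Then for every real γ with 0 < γ ≤ α there exist constants c > 0 and C > 0 (depending only on α, γ, A) such that for all x ≥ 2, the number of integers n ≤ x for which there is NO quadruple (k, p, q, r) with k ≥ 1 an integer, p, q, r primes, n = k·p + r, r ≡ 1 (mod q), and min{p²·k, p·k·r, q·r} ≥ c · n^(1+γ), is at most C · x^(max{0, 2γ−1}) · (log x)⁴. -/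
/-- `P(k)`: the largest prime divisor of `k`, with `P(0) = P(1) = 0`. -/
def maxPrimeFac (k : ℕ) : ℕ := k.primeFactors.sup id

/-- The additive character of `ℝ` sending `x` to `exp (2 * π * i * x)`. -/
noncomputable def unitChar (x : ℝ) : ℂ := Complex.exp ((2 * Real.pi * x : ℝ) * Complex.I)

theorem unitChar_add (x y : ℝ) : unitChar (x + y) = unitChar x * unitChar y := by
  rw [unitChar, unitChar, unitChar, ← Complex.exp_add]
  push_cast
  ring_nf

theorem norm_unitChar (x : ℝ) : ‖unitChar x‖ = 1 :=
  Complex.norm_exp_ofReal_mul_I _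

theorem unitChar_re (x : ℝ) : (unitChar x).re = Real.cos (2 * Real.pi * x) :=
  Complex.exp_ofReal_mul_I_re _

theorem conj_unitChar (x : ℝ) : (starRingEnd ℂ) (unitChar x) = unitChar (-x) := by
  rw [unitChar, unitChar, ← Complex.exp_conj, map_mul, Complex.conj_ofReal, Complex.conj_I]
  push_cast
  ring_nf

theorem unitChar_nat_mul (n : ℕ) (x : ℝ) : unitChar (n * x) = unitChar x ^ n := by
  rw [unitChar, unitChar, ← Complex.exp_nat_mul]
  push_cast
  ring_nf

theorem unitChar_eq_one_iff (x : ℝ) : unitChar x = 1 ↔ ∃ k : ℤ, x = k := by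
  have h : (2 * Real.pi * Complex.I : ℂ) ≠ 0 := by simp [Real.pi_ne_zero]
  rw [unitChar, Complex.exp_eq_one_iff]
  refine exists_congr fun k => ⟨fun hk => ?_, fun hk => by subst hk; push_cast; ring⟩
  have : (x : ℂ) = k := mul_right_cancel₀ h (by rw [← hk]; push_cast; ring)
  exact_mod_cast this

theorem sum_unitChar_div {M : ℕ} (hM : 0 < M) (d : ℤ) :
    ∑ t ∈ Finset.range M, unitChar (d * t / M) = if (M : ℤ) ∣ d then (M : ℂ) else 0 := by
  have hM' : (M : ℝ) ≠ 0 := by positivity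
  have hpow : ∀ t : ℕ, unitChar (d * t / M) = unitChar (d / M) ^ t := fun t => by
    rw [← unitChar_nat_mul]
    congr 1
    ring
  simp_rw [hpow]
  have hone : unitChar (d / M) = 1 ↔ (M : ℤ) ∣ d := by
    rw [unitChar_eq_one_iff]
    refine exists_congr fun k => ?_
    rw [div_eq_iff hM', mul_comm]
    exact_mod_cast Iff.rfl
  split_ifs with h
  · simp [hone.2 h]
  · rw [geom_sum_eq (mt hone.1 h), ← unitChar_nat_mul, mul_div_cancel₀ _ hM',
      (unitChar_eq_one_iff _).2 ⟨d, rfl⟩, sub_self, zero_div]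

theorem sum_mul_conj_unitChar {M : ℕ} (hM : 0 < M) (S T : Finset ℕ) (a b : ℕ → ℂ) :
    ∑ t ∈ Finset.range M, (∑ n ∈ S, a n * unitChar (n * t / M)) *
        (starRingEnd ℂ) (∑ m ∈ T, b m * unitChar (m * t / M)) =
      ∑ n ∈ S, ∑ m ∈ T, a n * (starRingEnd ℂ) (b m) *
        if (M : ℤ) ∣ (n : ℤ) - m then (M : ℂ) else 0 := by
  simp_rw [map_sum, Finset.sum_mul_sum]
  rw [Finset.sum_comm]
  refine Finset.sum_congr rfl fun n _ => ?_
  rw [Finset.sum_comm]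
  refine Finset.sum_congr rfl fun m _ => ?_
  rw [← sum_unitChar_div hM, Finset.mul_sum]
  refine Finset.sum_congr rfl fun t _ => ?_
  have : (((n : ℤ) - m : ℤ) : ℝ) * t / M = n * t / M + -(m * t / M) := by push_cast; ring
  rw [this, unitChar_add, ← conj_unitChar, map_mul]
  ring

theorem parseval_unitChar {M : ℕ} (hM : 0 < M) {S : Finset ℕ} (hS : S ⊆ Finset.range M)
    (b : ℕ → ℂ) :
    ∑ t ∈ Finset.range M, ‖∑ n ∈ S, b n * unitChar (n * t / M)‖ ^ 2 =
      M * ∑ n ∈ S, ‖b n‖ ^ 2 := by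
  have h := sum_mul_conj_unitChar hM S S b b
  have hdiag : ∀ n ∈ S, ∑ m ∈ S, b n * (starRingEnd ℂ) (b m) *
      (if (M : ℤ) ∣ (n : ℤ) - m then (M : ℂ) else 0) = M * (‖b n‖ ^ 2 : ℝ) := by
    intro n hn
    rw [Finset.sum_eq_single n]
    · simp [Complex.mul_conj, Complex.normSq_eq_norm_sq, mul_comm]
    · intro m hm hmn
      rw [if_neg, mul_zero]
      intro hdvd
      have h1 := Finset.mem_range.1 (hS hn)
      have h2 := Finset.mem_range.1 (hS hm)
      have := Int.eq_zero_of_abs_lt_dvd hdvd (by rw [abs_lt]; omega)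
      omega
    · exact fun h => absurd hn h
  rw [Finset.sum_congr rfl hdiag] at h
  simp_rw [Complex.mul_conj, Complex.normSq_eq_norm_sq] at h
  rw [← Finset.mul_sum] at h
  exact_mod_cast h

/-- The additive large sieve at the fractions `h / p`, `p` prime. -/
theorem large_sieve_primes {N Q : ℕ} (hN : 0 < N) {S P : Finset ℕ} (hS : S ⊆ Finset.range N)
    (hP : ∀ p ∈ P, p.Prime ∧ p ≤ Q) :
    ∑ i ∈ P.sigma (fun p => Finset.Ico 1 p), ‖∑ n ∈ S, unitChar (n * i.2 / i.1)‖ ^ 2 ≤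
      4 * (6 * N + Q ^ 2) * S.card := by
  set L : ℕ := 6 * N + Q ^ 2 with hL
  set J : ℕ := ∏ p ∈ P, p with hJ
  have hJ0 : 0 < J := Finset.prod_pos fun p hp => (hP p hp).1.pos
  have hL0 : 0 < L := by positivity
  set M : ℕ := L * J with hMdef
  have hM : 0 < M := by positivity
  have hNM : N ≤ M := by nlinarith
  have hJR : (0 : ℝ) < J := by exact_mod_cast hJ0
  have hMR : (0 : ℝ) < M := by exact_mod_cast hM
  let w : ℕ → ℂ := fun n => (J : ℂ)⁻¹ * ∑ j ∈ Finset.range J, unitChar (n * j / M)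
  have hw : ∀ n ∈ S, 1 / 2 ≤ ‖w n‖ := by
    intro n hn
    refine le_trans ?_ (Complex.re_le_norm _)
    have hre : (w n).re = (J : ℝ)⁻¹ * ∑ j ∈ Finset.range J, Real.cos (2 * Real.pi * (n * j / M)) := by
      simp only [w]
      rw [show (J : ℂ)⁻¹ = ((J : ℝ)⁻¹ : ℝ) by push_cast; rfl, Complex.re_ofReal_mul,
        Complex.re_sum]
      simp_rw [unitChar_re]
    have hcos : ∀ j ∈ Finset.range J, (1 / 2 : ℝ) ≤ Real.cos (2 * Real.pi * (n * j / M)) := by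
      intro j hj
      have hj' := Finset.mem_range.1 hj
      have hn' := Finset.mem_range.1 (hS hn)
      have hle : (n * j / M : ℝ) ≤ 1 / 6 := by
        rw [div_le_iff₀ hMR]
        have : 6 * (n * j) ≤ M := by
          calc 6 * (n * j) ≤ 6 * (N * J) := by gcongr
            _ ≤ M := by rw [hMdef, hL]; nlinarith [Nat.zero_le (Q ^ 2 * J)]
        have : (6 * (n * j) : ℝ) ≤ M := by exact_mod_cast this
        linarith
      rw [← Real.cos_pi_div_three]
      apply Real.cos_le_cos_of_nonneg_of_le_pi
      · positivity
      · linarith [Real.pi_pos]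
      · nlinarith [Real.pi_pos]
    rw [hre, inv_mul_eq_div, le_div_iff₀ hJR]
    have := Finset.card_nsmul_le_sum _ _ _ hcos
    rw [Finset.card_range, nsmul_eq_mul] at this
    linarith
  let T : ℕ → ℂ := fun t => ∑ n ∈ S, (w n)⁻¹ * unitChar (n * t / M)
  have hST : ∀ t : ℕ, ∑ n ∈ S, unitChar (n * t / M) =
      (J : ℂ)⁻¹ * ∑ j ∈ Finset.range J, T (t + j) := by
    intro t
    simp only [T]
    rw [Finset.sum_comm, Finset.mul_sum]
    refine Finset.sum_congr rfl fun n hn => ?_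
    have hwn : w n ≠ 0 := by
      have := hw n hn
      intro h0
      rw [h0, norm_zero] at this
      norm_num at this
    have hsplit : ∀ j : ℕ, unitChar (n * (t + j : ℕ) / M) =
        unitChar (n * t / M) * unitChar (n * j / M) := fun j => by
      rw [← unitChar_add]
      congr 1
      push_cast
      ring
    simp_rw [hsplit, ← mul_assoc]
    rw [← Finset.mul_sum]
    calc unitChar (n * t / M) = (w n)⁻¹ * w n * unitChar (n * t / M) := by
          rw [inv_mul_cancel₀ hwn, one_mul]
      _ = _ := by simp only [w]; ring
  have hbound : ∀ t : ℕ, ‖∑ n ∈ S, unitChar (n * t / M)‖ ^ 2 ≤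
      (J : ℝ)⁻¹ * ∑ j ∈ Finset.range J, ‖T (t + j)‖ ^ 2 := by
    intro t
    rw [hST, norm_mul, mul_pow, norm_inv, Complex.norm_natCast]
    have h1 : ‖∑ j ∈ Finset.range J, T (t + j)‖ ^ 2 ≤
        J * ∑ j ∈ Finset.range J, ‖T (t + j)‖ ^ 2 := by
      calc _ ≤ (∑ j ∈ Finset.range J, ‖T (t + j)‖) ^ 2 := by gcongr; exact norm_sum_le _ _
        _ ≤ _ := by
          simpa using sq_sum_le_card_mul_sum_sq (s := Finset.range J) (f := fun j => ‖T (t + j)‖)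
    calc _ ≤ ((J : ℝ)⁻¹) ^ 2 * (J * ∑ j ∈ Finset.range J, ‖T (t + j)‖ ^ 2) := by gcongr
      _ = _ := by field_simp
  let τ : (_ : ℕ) × ℕ → ℕ := fun i => i.2 * (L * (J / i.1))
  have hJdiv : ∀ p ∈ P, p * (J / p) = J := fun p hp =>
    Nat.mul_div_cancel' (Finset.dvd_prod_of_mem _ hp)
  have hτ : ∀ i ∈ P.sigma (fun p => Finset.Ico 1 p), i.1 * τ i = i.2 * M := by
    intro i hi
    simp only [τ]
    calc _ = i.2 * L * (i.1 * (J / i.1)) := by ring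
      _ = _ := by rw [hJdiv _ (Finset.mem_sigma.1 hi).1]; ring
  have hτS : ∀ i ∈ P.sigma (fun p => Finset.Ico 1 p), ‖∑ n ∈ S, unitChar (n * i.2 / i.1)‖ ^ 2 ≤
      (J : ℝ)⁻¹ * ∑ j ∈ Finset.range J, ‖T (τ i + j)‖ ^ 2 := by
    intro i hi
    refine le_trans (le_of_eq ?_) (hbound (τ i))
    congr 2
    refine Finset.sum_congr rfl fun n _ => ?_
    congr 1
    have hp0 : (i.1 : ℝ) ≠ 0 := by
      exact_mod_cast (hP _ (Finset.mem_sigma.1 hi).1).1.ne_zero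
    have : (i.1 * τ i : ℝ) = i.2 * M := by exact_mod_cast hτ i hi
    rw [div_eq_div_iff hp0 hMR.ne']
    linear_combination -(n : ℝ) * this
  have hinj : ∑ i ∈ P.sigma (fun p => Finset.Ico 1 p), ∑ j ∈ Finset.range J, ‖T (τ i + j)‖ ^ 2 ≤
      ∑ t ∈ Finset.range M, ‖T t‖ ^ 2 := by
    rw [← Finset.sum_product']
    rw [← Finset.sum_image (f := fun t => ‖T t‖ ^ 2) (g := fun x : ((_ : ℕ) × ℕ) × ℕ => τ x.1 + x.2)]
    · refine Finset.sum_le_sum_of_subset_of_nonneg ?_ fun _ _ _ => by positivity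
      intro t ht
      obtain ⟨⟨i, j⟩, hx, rfl⟩ := Finset.mem_image.1 ht
      obtain ⟨hi, hj⟩ := Finset.mem_product.1 hx
      have hτi := hτ i hi
      obtain ⟨hip, hih⟩ := Finset.mem_sigma.1 hi
      have hj' := Finset.mem_range.1 hj
      have hh := Finset.mem_Ico.1 hih
      have hpL : i.1 ≤ L := by
        have := (hP _ hip).2
        nlinarith
      rw [Finset.mem_range]
      have hp0 := (hP _ hip).1.pos
      refine lt_of_mul_lt_mul_left (a := i.1) ?_ (Nat.zero_le _)
      simp only at hj' ⊢
      calc i.1 * (τ i + j) = i.2 * M + i.1 * j := by rw [mul_add, hτi]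
        _ < i.2 * M + L * J := by
          have : i.1 * j < i.1 * J := Nat.mul_lt_mul_of_pos_left hj' hp0
          nlinarith
        _ = (i.2 + 1) * M := by rw [hMdef]; ring
        _ ≤ i.1 * M := Nat.mul_le_mul_right _ hh.2
    · rintro ⟨i, j⟩ hx ⟨i', j'⟩ hx' heq
      obtain ⟨hi, hj⟩ := Finset.mem_product.1 hx
      obtain ⟨hi', hj'⟩ := Finset.mem_product.1 hx'
      have e1 : (i.1 * τ i : ℤ) = i.2 * M := by exact_mod_cast hτ i hi
      have e2 : (i'.1 * τ i' : ℤ) = i'.2 * M := by exact_mod_cast hτ i' hi'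
      obtain ⟨hip, hih⟩ := Finset.mem_sigma.1 hi
      obtain ⟨hip', hih'⟩ := Finset.mem_sigma.1 hi'
      have hh : 1 ≤ i.2 ∧ i.2 < i.1 := Finset.mem_Ico.1 hih
      have hjl := Finset.mem_range.1 hj
      have hjl' := Finset.mem_range.1 hj'
      simp only at heq hjl hjl'
      have e3 : ((i.2 : ℤ) * i'.1 - i'.2 * i.1) * M = i.1 * i'.1 * (j' - j) := by
        have : (τ i + j : ℤ) = τ i' + j' := by exact_mod_cast heq
        linear_combination (i'.1 : ℤ) * -e1 + i.1 * e2 + i.1 * i'.1 * this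
      have hQ : (i.1 * i'.1 : ℤ) < L := by
        have h1 := (hP _ hip).2
        have h2 := (hP _ hip').2
        have : i.1 * i'.1 ≤ Q * Q := Nat.mul_le_mul h1 h2
        have : i.1 * i'.1 < L := by rw [hL]; nlinarith
        exact_mod_cast this
      have hp0 := (hP _ hip).1.pos
      have habs : |(i.2 : ℤ) * i'.1 - i'.2 * i.1| < 1 := by
        have hJZ : (0 : ℤ) < J := by exact_mod_cast hJ0
        have hMZ : (0 : ℤ) < M := by exact_mod_cast hM
        have hjj : |(j' : ℤ) - j| < J := by rw [abs_lt]; omega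
        refine lt_of_mul_lt_mul_right (a := (M : ℤ)) ?_ hMZ.le
        rw [one_mul]
        calc |(i.2 : ℤ) * i'.1 - i'.2 * i.1| * M = |((i.2 : ℤ) * i'.1 - i'.2 * i.1) * M| := by
              rw [abs_mul, abs_of_pos hMZ]
          _ = (i.1 * i'.1) * |(j' : ℤ) - j| := by
              rw [e3, abs_mul, abs_of_nonneg (by positivity)]
          _ < L * J := by
              apply mul_lt_mul'' hQ hjj <;> positivity
          _ = M := by rw [hMdef]; push_cast; ring
      rw [Int.abs_lt_one_iff, sub_eq_zero] at habs
      have habsN : i.2 * i'.1 = i'.2 * i.1 := by exact_mod_cast habs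
      have hpp : i.1 = i'.1 := by
        have hdvd : i.1 ∣ i.2 * i'.1 := ⟨i'.2, by rw [habsN, mul_comm]⟩
        rcases (hP _ hip).1.dvd_mul.1 hdvd with h | h
        · exact absurd (Nat.le_of_dvd hh.1 h) (not_le.2 hh.2)
        · exact (Nat.prime_dvd_prime_iff_eq (hP _ hip).1 (hP _ hip').1).1 h
      have hii : i = i' := by
        rcases i with ⟨p, h⟩
        rcases i' with ⟨p', h'⟩
        simp only at hpp habsN hp0
        subst hpp
        rw [Nat.eq_of_mul_eq_mul_right hp0 habsN]
      subst hii
      simpa using heq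
  have hb : ∀ n ∈ S, ‖(w n)⁻¹‖ ^ 2 ≤ (4 : ℝ) := by
    intro n hn
    have h1 := hw n hn
    rw [norm_inv]
    have : ‖w n‖⁻¹ ≤ 2 := by
      rw [inv_le_comm₀ (by linarith) (by norm_num)]
      linarith
    have h0 : 0 ≤ ‖w n‖⁻¹ := by positivity
    nlinarith
  calc _ ≤ ∑ i ∈ P.sigma (fun p => Finset.Ico 1 p),
        (J : ℝ)⁻¹ * ∑ j ∈ Finset.range J, ‖T (τ i + j)‖ ^ 2 := Finset.sum_le_sum hτS
    _ ≤ (J : ℝ)⁻¹ * ∑ t ∈ Finset.range M, ‖T t‖ ^ 2 := by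
        rw [← Finset.mul_sum]
        gcongr
    _ = (J : ℝ)⁻¹ * (M * ∑ n ∈ S, ‖(w n)⁻¹‖ ^ 2) := by
        rw [parseval_unitChar hM (hS.trans (Finset.range_mono hNM))]
    _ ≤ (J : ℝ)⁻¹ * (M * ∑ n ∈ S, (4 : ℝ)) := by gcongr with n hn; exact hb n hn
    _ = _ := by
        rw [Finset.sum_const, nsmul_eq_mul, hMdef, hL]
        push_cast
        field_simp

/-- Two sets of integers occupying disjoint sets of residue classes modulo many primes cannot both
be large. -/
theorem card_mul_card_le_of_disjoint_residues {N Q : ℕ} (hN : 0 < N) {E R P : Finset ℕ}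
    (hE : E ⊆ Finset.range N) (hR : R ⊆ Finset.range N) (hP : ∀ p ∈ P, p.Prime ∧ p ≤ Q)
    (hER : ∀ p ∈ P, ∀ n ∈ E, ∀ r ∈ R, ¬ (p : ℤ) ∣ (n : ℤ) - r) :
    (P.card : ℝ) ^ 2 * E.card * R.card ≤ (4 * (6 * N + Q ^ 2)) ^ 2 := by
  rcases E.eq_empty_or_nonempty with rfl | hE0
  · simp; positivity
  rcases R.eq_empty_or_nonempty with rfl | hR0
  · simp; positivity
  have hE1 : (0 : ℝ) < E.card := by exact_mod_cast hE0.card_pos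
  have hR1 : (0 : ℝ) < R.card := by exact_mod_cast hR0.card_pos
  let F : Finset ℕ → (_ : ℕ) × ℕ → ℂ := fun S i => ∑ n ∈ S, unitChar (n * i.2 / i.1)
  have hp : ∀ p ∈ P, (E.card * R.card : ℝ) ≤
      ∑ h ∈ Finset.Ico 1 p, ‖F E ⟨p, h⟩‖ * ‖F R ⟨p, h⟩‖ := by
    intro p hp
    have hp0 := (hP p hp).1.pos
    have h := sum_mul_conj_unitChar hp0 E R (fun _ => 1) (fun _ => 1)
    rw [Finset.sum_eq_zero (s := E) fun n hn => Finset.sum_eq_zero fun m hm => by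
      rw [if_neg (hER p hp n hn m hm), mul_zero]] at h
    rw [Finset.range_eq_Ico, Finset.sum_eq_sum_Ico_succ_bot hp0] at h
    simp only [one_mul, Nat.cast_zero, mul_zero, zero_div, zero_add] at h
    rw [show unitChar 0 = 1 by simp [unitChar]] at h
    simp only [Finset.sum_const, nsmul_eq_mul, mul_one, Complex.conj_natCast] at h
    rw [add_eq_zero_iff_eq_neg] at h
    have h' := congrArg norm h
    rw [norm_mul, Complex.norm_natCast, Complex.norm_natCast, norm_neg] at h'
    rw [h']
    refine (norm_sum_le _ _).trans (Finset.sum_le_sum fun t _ => ?_)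
    rw [norm_mul, RCLike.norm_conj]
  set I := P.sigma (fun p => Finset.Ico 1 p)
  have hsum : (P.card * (E.card * R.card) : ℝ) ≤ ∑ i ∈ I, ‖F E i‖ * ‖F R i‖ := by
    rw [Finset.sum_sigma, ← nsmul_eq_mul]
    exact Finset.card_nsmul_le_sum _ _ _ hp
  have hCS := Finset.sum_mul_sq_le_sq_mul_sq I (fun i => ‖F E i‖) (fun i => ‖F R i‖)
  have h1 := large_sieve_primes hN hE hP
  have h2 := large_sieve_primes hN hR hP
  have h3 : (P.card * (E.card * R.card) : ℝ) ^ 2 ≤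
      (4 * (6 * N + Q ^ 2) * E.card) * (4 * (6 * N + Q ^ 2) * R.card) := by
    calc _ ≤ _ := by gcongr
      _ ≤ _ := hCS
      _ ≤ _ := by
        apply mul_le_mul h1 h2 <;> positivity
  refine le_of_mul_le_mul_right (a := (E.card * R.card : ℝ)) ?_ (by positivity)
  linarith

theorem maxPrimeFac_prime_and_dvd {k : ℕ} (h : 0 < maxPrimeFac k) :
    (maxPrimeFac k).Prime ∧ maxPrimeFac k ∣ k := by
  rcases k.primeFactors.eq_empty_or_nonempty with h0 | h0
  · simp [maxPrimeFac, h0] at h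
  · obtain ⟨q, hq, hqe⟩ := Finset.exists_mem_eq_sup _ h0 id
    rw [maxPrimeFac, hqe]
    exact ⟨Nat.prime_of_mem_primeFactors hq, Nat.dvd_of_mem_primeFactors hq⟩

/-- A positive proportion of primes `r` with `P(r - 1) > r ^ α` survives the restriction to
`δz < r ≤ z` for small `δ`. -/
theorem eventually_exists_primes_maxPrimeFac {α A : ℝ} (hA : 0 < A)
    (hyp : ∃ z₀ : ℝ, ∀ z : ℝ, z₀ ≤ z →
      A * z / Real.log z ≤
        (Set.ncard {r : ℕ | Nat.Prime r ∧ (r : ℝ) ≤ z ∧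
          (r : ℝ) ^ α < (maxPrimeFac (r - 1) : ℝ)} : ℝ)) :
    ∃ δ : ℝ, 0 < δ ∧ δ ≤ 1 ∧ ∀ᶠ z : ℝ in Filter.atTop, ∃ G : Finset ℕ,
      (∀ r ∈ G, r.Prime ∧ δ * z < r ∧ (r : ℝ) ≤ z ∧
        (r : ℝ) ^ α < (maxPrimeFac (r - 1) : ℝ)) ∧ A / 2 * z / Real.log z ≤ G.card := by
  classical
  obtain ⟨z₀, hz₀⟩ := hyp
  set δ : ℝ := min 1 (A / 12) with hδ
  have hδ0 : 0 < δ := by positivity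
  have hδA : δ ≤ A / 12 := min_le_right _ _
  refine ⟨δ, hδ0, min_le_left _ _, ?_⟩
  have hcheb := (Filter.tendsto_id.const_mul_atTop hδ0).eventually
    (Chebyshev.eventually_primeCounting_le one_pos)
  filter_upwards [Filter.eventually_ge_atTop z₀, hcheb, Filter.eventually_gt_atTop 1,
    Real.tendsto_log_atTop.eventually_ge_atTop (-2 * Real.log δ)] with z hz hπ hz1 hlog
  simp only [id] at hπ
  have hlz : 0 < Real.log z := Real.log_pos hz1
  have hlδ : Real.log z / 2 ≤ Real.log (δ * z) := by
    rw [Real.log_mul hδ0.ne' (by positivity)]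
    linarith
  have hlog4 : Real.log 4 + 1 ≤ 3 := by
    have : Real.log 4 = 2 * Real.log 2 := by
      rw [show (4 : ℝ) = 2 ^ 2 by norm_num, Real.log_pow]
      norm_num
    linarith [Real.log_two_lt_d9]
  have hπ' : (Nat.primeCounting ⌊δ * z⌋₊ : ℝ) ≤ A / 2 * z / Real.log z := by
    calc _ ≤ (Real.log 4 + 1) * (δ * z) / Real.log (δ * z) := hπ
      _ ≤ 3 * (A / 12 * z) / (Real.log z / 2) := by gcongr
      _ = _ := by field_simp; norm_num
  set B := (Finset.range (⌊z⌋₊ + 1)).filter fun r : ℕ =>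
    r.Prime ∧ (r : ℝ) ^ α < (maxPrimeFac (r - 1) : ℝ) with hB
  have hBset : {r : ℕ | Nat.Prime r ∧ (r : ℝ) ≤ z ∧
      (r : ℝ) ^ α < (maxPrimeFac (r - 1) : ℝ)} = (B : Set ℕ) := by
    ext r
    simp only [hB, Set.mem_ofPred_eq, Finset.coe_filter, Finset.mem_range, Nat.lt_succ_iff,
      Nat.le_floor_iff (by linarith : 0 ≤ z)]
    tauto
  have hcard := hz₀ z hz
  rw [hBset, Set.ncard_coe_finset] at hcard
  refine ⟨B.filter fun r : ℕ => δ * z < r, ?_, ?_⟩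
  · intro r hr
    rw [Finset.mem_filter, hB, Finset.mem_filter, Finset.mem_range, Nat.lt_succ_iff,
      Nat.le_floor_iff (by linarith : 0 ≤ z)] at hr
    tauto
  · have hsmall : (B.filter fun r : ℕ => ¬ δ * z < r).card ≤ Nat.primeCounting ⌊δ * z⌋₊ := by
      rw [Nat.primeCounting, Nat.primeCounting', Nat.count_eq_card_filter_range]
      refine Finset.card_le_card fun r hr => ?_
      rw [Finset.mem_filter, hB, Finset.mem_filter] at hr
      rw [Finset.mem_filter, Finset.mem_range, Nat.lt_succ_iff]
      exact ⟨Nat.le_floor (not_lt.1 hr.2), hr.1.2.1⟩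
    have hsplit := Finset.card_filter_add_card_filter_not (s := B) fun r : ℕ => δ * z < r
    have h1 : (B.card : ℝ) ≤ (B.filter fun r : ℕ => δ * z < r).card +
        Nat.primeCounting ⌊δ * z⌋₊ := by
      exact_mod_cast hsplit ▸ Nat.add_le_add_left hsmall _
    have h2 : A * z / Real.log z = A / 2 * z / Real.log z + A / 2 * z / Real.log z := by ring
    linarith

/-- `n` has a representation `n = kp + r` of the kind counted by the maximum `f(n)`, with value at
least `c n ^ (1 + γ)`. -/
def HasRepr (c γ : ℝ) (n : ℕ) : Prop :=
  ∃ k p q r : ℕ, 1 ≤ k ∧ Nat.Prime p ∧ Nat.Prime q ∧ Nat.Prime r ∧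
    n = k * p + r ∧ r % q = 1 % q ∧
    c * (n : ℝ) ^ (1 + γ) ≤ min (min ((p : ℝ) ^ 2 * k) ((p : ℝ) * k * r)) ((q : ℝ) * r)

theorem hasRepr_of_dvd_sub {α γ δ X : ℝ} (hγ0 : 0 < γ) (hγα : γ ≤ α) (hα1 : α < 1) (hδ0 : 0 < δ)
    (hδ1 : δ ≤ 1) (hX : 1 ≤ X) {n p r : ℕ} (hn : 2 * X < n) (hn' : n ≤ 4 * X) (hp : p.Prime)
    (hpX : δ * X ^ γ ≤ p) (hr : r.Prime) (hrX : δ * X ≤ r) (hrX' : r ≤ X)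
    (hrα : (r : ℝ) ^ α < maxPrimeFac (r - 1)) (hdvd : (p : ℤ) ∣ (n : ℤ) - r) :
    HasRepr (δ ^ 2 / 16) γ n := by
  have hrn : r < n := by
    have : (r : ℝ) < n := by linarith
    exact_mod_cast this
  obtain ⟨k, hk⟩ : p ∣ n - r := by
    rw [← Nat.cast_sub hrn.le] at hdvd
    exact_mod_cast hdvd
  have hq : 0 < maxPrimeFac (r - 1) := by
    have : (0 : ℝ) < maxPrimeFac (r - 1) := lt_of_le_of_lt (by positivity) hrα
    exact_mod_cast this
  obtain ⟨hqp, hqd⟩ := maxPrimeFac_prime_and_dvd hq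
  set q := maxPrimeFac (r - 1)
  have hn1 : (1 : ℝ) ≤ n := by linarith
  have hkp : (p : ℝ) * k = n - r := by
    have : p * k + r = n := by omega
    rw [← this]
    push_cast
    ring
  have hm : (n : ℝ) / 2 ≤ p * k := by linarith
  have hr4 : δ / 4 * n ≤ r := by nlinarith
  set u : ℝ := (n : ℝ) ^ γ with hu
  have hu0 : 0 < u := by positivity
  have hun : u ≤ n := by
    calc u ≤ (n : ℝ) ^ (1 : ℝ) := Real.rpow_le_rpow_of_exponent_le hn1 (by linarith)
      _ = n := Real.rpow_one _
  have hp4 : δ / 4 * u ≤ p := by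
    refine le_trans ?_ hpX
    have h1 : u ≤ 4 * X ^ γ := by
      calc u ≤ (4 * X) ^ γ := by rw [hu]; gcongr
        _ = 4 ^ γ * X ^ γ := Real.mul_rpow (by norm_num) (by linarith)
        _ ≤ 4 ^ (1 : ℝ) * X ^ γ := by
          gcongr
          · norm_num
          · linarith
        _ = _ := by rw [Real.rpow_one]
    nlinarith
  have hq4 : δ / 4 * u ≤ q := by
    refine le_trans ?_ hrα.le
    calc δ / 4 * u ≤ (δ / 4) ^ α * (n : ℝ) ^ α := by
          gcongr
          · calc δ / 4 = (δ / 4) ^ (1 : ℝ) := (Real.rpow_one _).symm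
              _ ≤ _ := Real.rpow_le_rpow_of_exponent_ge (by positivity) (by linarith) hα1.le
          · exact Real.rpow_le_rpow_of_exponent_le hn1 hγα
      _ = (δ / 4 * n) ^ α := (Real.mul_rpow (by positivity) (by positivity)).symm
      _ ≤ _ := by gcongr; linarith
  have hnu : (n : ℝ) ^ (1 + γ) = n * u := by
    rw [Real.rpow_add (by positivity), Real.rpow_one]
  have hδ8 : δ ^ 2 / 16 ≤ δ / 8 := by nlinarith
  refine ⟨k, p, q, r, ?_, hp, hqp, hr, ?_, ?_, ?_⟩
  · refine Nat.one_le_iff_ne_zero.2 fun h0 => ?_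
    rw [h0, mul_zero] at hk
    omega
  · rw [mul_comm, ← hk]
    omega
  · exact ((Nat.modEq_iff_dvd' hr.one_le).2 hqd).symm
  · rw [hnu]
    have hbase : δ ^ 2 / 16 * (n * u) ≤ δ / 8 * (n * u) := by gcongr
    refine le_min (le_min ?_ ?_) ?_
    · calc _ ≤ _ := hbase
        _ = (δ / 4 * u) * (n / 2) := by ring
        _ ≤ p * (p * k) := by gcongr
        _ = _ := by ring
    · calc _ ≤ _ := hbase
        _ ≤ δ / 8 * (n * n) := by gcongr
        _ = (n / 2) * (δ / 4 * n) := by ring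
        _ ≤ _ := by gcongr
    · calc _ = (δ / 4 * u) * (δ / 4 * n) := by ring
        _ ≤ _ := by gcongr

/-- The dyadic form of the bound for the number of exceptional `n`. -/
theorem eventually_card_not_hasRepr_le {α A γ : ℝ} (hα1 : α < 1) (hA : 0 < A)
    (hyp : ∃ z₀ : ℝ, ∀ z : ℝ, z₀ ≤ z →
      A * z / Real.log z ≤
        (Set.ncard {r : ℕ | Nat.Prime r ∧ (r : ℝ) ≤ z ∧
          (r : ℝ) ^ α < (maxPrimeFac (r - 1) : ℝ)} : ℝ)) (hγ0 : 0 < γ) (hγα : γ ≤ α) :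
    ∃ c D : ℝ, 0 < c ∧ 0 < D ∧ ∀ᶠ X : ℝ in Filter.atTop, ∀ E : Finset ℕ,
      (∀ n ∈ E, 2 * X < n ∧ (n : ℝ) ≤ 4 * X ∧ ¬ HasRepr c γ n) →
      (E.card : ℝ) ≤ D * X ^ (max 0 (2 * γ - 1)) * Real.log X ^ 3 := by
  obtain ⟨δ, hδ0, hδ1, hev⟩ := eventually_exists_primes_maxPrimeFac hA hyp
  set β : ℝ := max γ (1 / 2) with hβ
  have hβ2 : 1 / 2 ≤ β := le_max_right _ _
  have hβγ : γ ≤ β := le_max_left _ _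
  have hβ1 : β ≤ 1 := max_le (by linarith) (by norm_num)
  have he : max 0 (2 * γ - 1) = 2 * β - 1 := by
    rw [hβ]
    rcases le_total γ (1 / 2) with h | h
    · rw [max_eq_right h, max_eq_left (by linarith)]
      norm_num
    · rw [max_eq_left h, max_eq_right (by linarith)]
  refine ⟨δ ^ 2 / 16, 15376 / (A / 2) ^ 3, by positivity, by positivity, ?_⟩
  filter_upwards [hev, (tendsto_rpow_atTop (by linarith : 0 < β)).eventually hev,
    Filter.eventually_gt_atTop 1] with X hR hP hX1 E hE
  obtain ⟨R, hR, hRcard⟩ := hR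
  obtain ⟨P, hP, hPcard⟩ := hP
  have hX0 : 0 < X := by linarith
  have hlX : 0 < Real.log X := Real.log_pos hX1
  have hmain := card_mul_card_le_of_disjoint_residues (N := ⌊4 * X⌋₊ + 1) (Q := ⌊X ^ β⌋₊)
    (E := E) (R := R) (P := P) (Nat.succ_pos _)
    (fun n hn => Finset.mem_range.2 (Nat.lt_succ_of_le (Nat.le_floor (hE n hn).2.1)))
    (fun r hr => Finset.mem_range.2 (Nat.lt_succ_of_le (Nat.le_floor (by
      linarith [(hR r hr).2.2.1]))))
    (fun p hp => ⟨(hP p hp).1, Nat.le_floor (hP p hp).2.2.1⟩)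
    (fun p hp n hn r hr hdvd => (hE n hn).2.2 <| by
      obtain ⟨hpp, hpX, -, -⟩ := hP p hp
      obtain ⟨hrp, hrX, hrX', hrα⟩ := hR r hr
      refine hasRepr_of_dvd_sub hγ0 hγα hα1 hδ0 hδ1 hX1.le (hE n hn).1 (hE n hn).2.1 hpp
        (le_trans ?_ hpX.le) hrp hrX.le hrX' hrα hdvd
      gcongr
      exact hX1.le)
  set Y : ℝ := X ^ β with hY
  have hY0 : 0 < Y := by positivity
  have hXY : X ≤ Y ^ 2 := by
    rw [hY, ← Real.rpow_natCast, ← Real.rpow_mul hX0.le]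
    calc X = X ^ (1 : ℝ) := (Real.rpow_one _).symm
      _ ≤ _ := Real.rpow_le_rpow_of_exponent_le hX1.le (by push_cast; linarith)
  have hL : 4 * (6 * ((⌊4 * X⌋₊ + 1 : ℕ) : ℝ) + (⌊Y⌋₊ : ℝ) ^ 2) ≤ 124 * Y ^ 2 := by
    have h1 : (⌊4 * X⌋₊ : ℝ) ≤ 4 * X := Nat.floor_le (by positivity)
    have h2 : (⌊Y⌋₊ : ℝ) ^ 2 ≤ Y ^ 2 := by gcongr; exact Nat.floor_le hY0.le
    push_cast
    linarith
  have hlY : Real.log Y = β * Real.log X := Real.log_rpow hX0 _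
  have hPc : A / 2 * Y / Real.log X ≤ P.card := by
    refine le_trans ?_ hPcard
    rw [hlY]
    gcongr
    nlinarith
  have hbound : (A / 2 * Y / Real.log X) ^ 2 * E.card * (A / 2 * X / Real.log X) ≤
      (124 * Y ^ 2) ^ 2 := by
    calc _ ≤ (P.card : ℝ) ^ 2 * E.card * R.card := by gcongr
      _ ≤ _ := hmain
      _ ≤ _ := by gcongr
  have hYX : X ^ (2 * β - 1) = Y ^ 2 / X := by
    rw [Real.rpow_sub hX0, Real.rpow_one, mul_comm, Real.rpow_mul hX0.le, ← hY]
    norm_num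
  rw [he, hYX]
  refine le_of_mul_le_mul_left (a := (A / 2 * Y / Real.log X) ^ 2 * (A / 2 * X / Real.log X)) ?_
    (by positivity)
  calc _ = (A / 2 * Y / Real.log X) ^ 2 * E.card * (A / 2 * X / Real.log X) := by ring
    _ ≤ _ := hbound
    _ = _ := by
      field_simp
      norm_num

/-- Summation of a dyadic bound. -/
theorem ncard_le_of_dyadic {S : Set ℕ} {D e T : ℝ} (hD : 0 ≤ D) (he : 0 ≤ e) (hT : 4 ≤ T)
    (h : ∀ X : ℝ, T ≤ 4 * X → ∀ E : Finset ℕ,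
      (∀ n ∈ E, 2 * X < n ∧ (n : ℝ) ≤ 4 * X ∧ n ∈ S) →
      (E.card : ℝ) ≤ D * X ^ e * Real.log X ^ 3) (m : ℕ) :
    ∀ x : ℝ, 1 ≤ x → x ≤ 2 ^ m * T →
      (Set.ncard {n : ℕ | 1 ≤ n ∧ (n : ℝ) ≤ x ∧ n ∈ S} : ℝ) ≤
        T + m * (D * x ^ e * Real.log x ^ 3) := by
  classical
  have htriv : ∀ x : ℝ, 1 ≤ x → x ≤ T →
      (Set.ncard {n : ℕ | 1 ≤ n ∧ (n : ℝ) ≤ x ∧ n ∈ S} : ℝ) ≤ T := by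
    intro x hx hxT
    have hsub : {n : ℕ | 1 ≤ n ∧ (n : ℝ) ≤ x ∧ n ∈ S} ⊆ (Finset.Icc 1 ⌊x⌋₊ : Finset ℕ) := by
      intro n hn
      rw [Finset.mem_coe, Finset.mem_Icc]
      exact ⟨hn.1, Nat.le_floor hn.2.1⟩
    have hc := Set.ncard_le_ncard hsub (Finset.finite_toSet _)
    rw [Set.ncard_coe_finset, Nat.card_Icc, Nat.add_sub_cancel] at hc
    calc _ ≤ (⌊x⌋₊ : ℝ) := by exact_mod_cast hc
      _ ≤ x := Nat.floor_le (by linarith)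
      _ ≤ T := hxT
  induction m with
  | zero =>
    intro x hx hxT
    simpa using htriv x hx (by simpa using hxT)
  | succ m ih =>
    intro x hx hxT
    have hl : 0 ≤ Real.log x := Real.log_nonneg hx
    have hterm : 0 ≤ D * x ^ e * Real.log x ^ 3 := by positivity
    rcases le_total x T with hxT' | hxT'
    · have := htriv x hx hxT'
      have : 0 ≤ ((m + 1 : ℕ) : ℝ) * (D * x ^ e * Real.log x ^ 3) := by positivity
      linarith
    · have hih := ih (x / 2) (by linarith) (by rw [pow_succ] at hxT; linarith)
      set E := (Finset.Icc 1 ⌊x⌋₊).filter fun n : ℕ => x / 2 < n ∧ n ∈ S with hEdef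
      have hE : (E.card : ℝ) ≤ D * x ^ e * Real.log x ^ 3 := by
        have h4 := h (x / 4) (by linarith) E (by
          intro n hn
          rw [hEdef, Finset.mem_filter, Finset.mem_Icc, Nat.le_floor_iff (by linarith)] at hn
          exact ⟨by linarith [hn.2.1], by linarith [hn.1.2], hn.2.2⟩)
        refine h4.trans ?_
        have h1 : 0 ≤ Real.log (x / 4) := Real.log_nonneg (by linarith)
        have h2 : x / 4 ≤ x := by linarith
        gcongr
      have hsub : {n : ℕ | 1 ≤ n ∧ (n : ℝ) ≤ x ∧ n ∈ S} ⊆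
          {n : ℕ | 1 ≤ n ∧ (n : ℝ) ≤ x / 2 ∧ n ∈ S} ∪ (E : Set ℕ) := by
        rintro n ⟨hn1, hnx, hnS⟩
        rcases le_or_gt (n : ℝ) (x / 2) with hn | hn
        · exact Or.inl ⟨hn1, hn, hnS⟩
        · refine Or.inr ?_
          rw [hEdef, Finset.mem_coe, Finset.mem_filter, Finset.mem_Icc]
          exact ⟨⟨hn1, Nat.le_floor hnx⟩, hn, hnS⟩
      have hfin : ({n : ℕ | 1 ≤ n ∧ (n : ℝ) ≤ x / 2 ∧ n ∈ S}).Finite :=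
        (Finset.finite_toSet (Finset.Icc 1 ⌊x / 2⌋₊)).subset fun n hn => by
          rw [Finset.mem_coe, Finset.mem_Icc]
          exact ⟨hn.1, Nat.le_floor hn.2.1⟩
      have hcard := (Set.ncard_le_ncard hsub (hfin.union (Finset.finite_toSet E))).trans
        (Set.ncard_union_le _ _)
      rw [Set.ncard_coe_finset] at hcard
      have hcard' : (Set.ncard {n : ℕ | 1 ≤ n ∧ (n : ℝ) ≤ x ∧ n ∈ S} : ℝ) ≤
          Set.ncard {n : ℕ | 1 ≤ n ∧ (n : ℝ) ≤ x / 2 ∧ n ∈ S} + E.card := by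
        exact_mod_cast hcard
      have hmono : (m : ℝ) * (D * (x / 2) ^ e * Real.log (x / 2) ^ 3) ≤
          m * (D * x ^ e * Real.log x ^ 3) := by
        have h1 : 0 ≤ Real.log (x / 2) := Real.log_nonneg (by linarith)
        have h2 : x / 2 ≤ x := by linarith
        gcongr
      push_cast
      linarith

/-- Assume there are `0 < α < 1` and `A > 0` with
`#{r ≤ z : r prime, P(r−1) > r^α} ≥ A·z/log z` for all sufficiently large `z`. Then for every
`0 < γ ≤ α` there exist `c, C > 0` (depending only on `α, γ, A`) such that for all `x ≥ 2`
the number of integers `n ≤ x` admitting no quadruple `(k, p, q, r)` with `k ≥ 1`,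
`p, q, r` prime, `n = k·p + r`, `r ≡ 1 (mod q)` and
`min {p²·k, p·k·r, q·r} ≥ c·n^(1+γ)` is at most `C·x^(max{0, 2γ−1})·(log x)⁴`. -/
theorem evasive_almost_all (α A : ℝ) (hα0 : 0 < α) (hα1 : α < 1) (hA : 0 < A)
    (hyp : ∃ z₀ : ℝ, ∀ z : ℝ, z₀ ≤ z →
      A * z / Real.log z ≤
        (Set.ncard {r : ℕ | Nat.Prime r ∧ (r : ℝ) ≤ z ∧
          (r : ℝ) ^ α < (maxPrimeFac (r - 1) : ℝ)} : ℝ)) :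
    ∀ γ : ℝ, 0 < γ → γ ≤ α →
      ∃ c C : ℝ, 0 < c ∧ 0 < C ∧ ∀ x : ℝ, 2 ≤ x →
        (Set.ncard {n : ℕ | 1 ≤ n ∧ (n : ℝ) ≤ x ∧
            ¬ ∃ k p q r : ℕ, 1 ≤ k ∧ Nat.Prime p ∧ Nat.Prime q ∧ Nat.Prime r ∧
              n = k * p + r ∧ r % q = 1 % q ∧
              c * (n : ℝ) ^ (1 + γ) ≤
                min (min ((p : ℝ) ^ 2 * k) ((p : ℝ) * k * r)) ((q : ℝ) * r)} : ℝ) ≤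
          C * x ^ (max 0 (2 * γ - 1)) * Real.log x ^ 4 := by
  intro γ hγ0 hγα
  obtain ⟨c, D, hc, hD, hev⟩ := eventually_card_not_hasRepr_le hα1 hA hyp hγ0 hγα
  obtain ⟨X₀, hX₀⟩ := Filter.eventually_atTop.1 hev
  set T : ℝ := max 4 (4 * X₀) with hT
  have hT4 : 4 ≤ T := le_max_left _ _
  have hTX : 4 * X₀ ≤ T := le_max_right _ _
  set e : ℝ := max 0 (2 * γ - 1) with he
  have he0 : 0 ≤ e := le_max_left _ _
  have hl2 : 0 < Real.log 2 := Real.log_pos (by norm_num)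
  refine ⟨c, T / Real.log 2 ^ 4 + 2 / Real.log 2 * D, hc, by positivity, fun x hx => ?_⟩
  have hx0 : 0 < x := by linarith
  have hlx : Real.log 2 ≤ Real.log x := Real.log_le_log (by norm_num) hx
  have hlx0 : 0 < Real.log x := hl2.trans_le hlx
  set m := ⌈Real.log x / Real.log 2⌉₊ with hm
  have hmx : x ≤ 2 ^ m * T := by
    have h1 : x ≤ 2 ^ m := by
      rw [← Real.log_le_log_iff hx0 (by positivity), Real.log_pow, ← div_le_iff₀ hl2]
      exact Nat.le_ceil _
    nlinarith [pow_pos (two_pos : (0 : ℝ) < 2) m]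
  have hm2 : (m : ℝ) ≤ 2 / Real.log 2 * Real.log x := by
    have h1 : (m : ℝ) < Real.log x / Real.log 2 + 1 := Nat.ceil_lt_add_one (by positivity)
    have h2 : 1 ≤ Real.log x / Real.log 2 := (one_le_div hl2).2 hlx
    have h3 : 2 / Real.log 2 * Real.log x = Real.log x / Real.log 2 + Real.log x / Real.log 2 := by
      ring
    linarith
  have hxe : 1 ≤ x ^ e := Real.one_le_rpow (by linarith) he0
  refine (ncard_le_of_dyadic (S := {n | ¬ HasRepr c γ n}) hD.le he0 hT4
    (fun X hX => hX₀ X (by linarith)) m x (by linarith) hmx).trans ?_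
  calc T + m * (D * x ^ e * Real.log x ^ 3)
      ≤ T / Real.log 2 ^ 4 * (x ^ e * Real.log x ^ 4) +
        (2 / Real.log 2 * Real.log x) * (D * x ^ e * Real.log x ^ 3) := by
        gcongr
        calc T = T / Real.log 2 ^ 4 * (1 * Real.log 2 ^ 4) := by field_simp
          _ ≤ _ := by gcongr
    _ = _ := by ring
end

section
/- Let 0 < γ ≤ α ≤ 1 and 0 < c₀ < 1/4 be reals, and let n ≥ 2 be an integer. Suppose r is a prime with c₀·n ≤ r ≤ n/2, P(r−1) ≥ r^α, and P(n−r) ≥ n^γ. Set p = P(n−r), q = P(r−1), and k = (n−r)/p. Then k is a positive integer, n = k·p + r, r ≡ 1 (mod q), and min{p²·k, p·k·r, q·r} ≥ (c₀²/2) · n^(1+γ). -/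
/-- `maxPrimeFac m` divides `m` as soon as it is nonzero. -/
theorem maxPrimeFac_dvd_of_pos {m : ℕ} (h : 0 < maxPrimeFac m) : maxPrimeFac m ∣ m := by
  have hne : m.primeFactors.Nonempty := by
    by_contra hempty
    simp [maxPrimeFac, Finset.not_nonempty_iff_eq_empty.mp hempty] at h
  obtain ⟨x, hx, hxm⟩ := Finset.exists_mem_eq_sup m.primeFactors hne id
  rw [maxPrimeFac, hxm]
  exact Nat.dvd_of_mem_primeFactors hx

/-- Let `0 < γ ≤ α ≤ 1` and `0 < c₀ < 1/4` be reals, `n ≥ 2` an integer.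
Suppose `r` is a prime with `c₀·n ≤ r ≤ n/2`, `P(r−1) ≥ r^α` and `P(n−r) ≥ n^γ`. Set
`p = P(n−r)`, `q = P(r−1)` and `k = (n−r)/p`. Then `k` is a positive integer,
`n = k·p + r`, `r ≡ 1 (mod q)`, and `min {p²·k, p·k·r, q·r} ≥ (c₀²/2)·n^(1+γ)`. -/
theorem quadruple_from_smooth_shifted_prime
    (γ α c₀ : ℝ) (hγ0 : 0 < γ) (hγα : γ ≤ α) (hα1 : α ≤ 1)
    (hc₀0 : 0 < c₀) (hc₀1 : c₀ < 1 / 4)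
    (n r : ℕ) (hn : 2 ≤ n) (hr : Nat.Prime r)
    (hrlo : c₀ * (n : ℝ) ≤ (r : ℝ)) (hrhi : (r : ℝ) ≤ (n : ℝ) / 2)
    (hPr : (r : ℝ) ^ α ≤ (maxPrimeFac (r - 1) : ℝ))
    (hPnr : (n : ℝ) ^ γ ≤ (maxPrimeFac (n - r) : ℝ))
    (p q k : ℕ)
    (hp : p = maxPrimeFac (n - r)) (hq : q = maxPrimeFac (r - 1))
    (hk : k = (n - r) / p) :
    1 ≤ k ∧ n = k * p + r ∧ r % q = 1 % q ∧
      c₀ ^ 2 / 2 * (n : ℝ) ^ (1 + γ) ≤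
        min (min ((p : ℝ) ^ 2 * k) ((p : ℝ) * k * r)) ((q : ℝ) * r) := by
  have hn1 : (1 : ℝ) ≤ n := by exact_mod_cast one_le_two.trans hn
  have hn0 : (0 : ℝ) < n := by linarith
  have hr1 : (1 : ℝ) ≤ r := by exact_mod_cast hr.one_lt.le
  have hr0 : (0 : ℝ) < r := by linarith
  have hrn : r < n := by
    have : (r : ℝ) < n := by linarith
    exact_mod_cast this
  rw [← hp] at hPnr
  rw [← hq] at hPr
  have hp0 : 0 < p := by exact_mod_cast (Real.rpow_pos_of_pos hn0 γ).trans_le hPnr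
  have hq0 : 0 < q := by exact_mod_cast (Real.rpow_pos_of_pos hr0 α).trans_le hPr
  have hpd : p ∣ n - r := by
    subst hp
    exact maxPrimeFac_dvd_of_pos hp0
  have hqd : q ∣ r - 1 := by
    subst hq
    exact maxPrimeFac_dvd_of_pos hq0
  have hkp : k * p = n - r := by rw [hk, Nat.div_mul_cancel hpd]
  have hkpr : n = k * p + r := by omega
  have hkpR : (n : ℝ) = k * p + r := by exact_mod_cast hkpr
  have hhalf : (n : ℝ) / 2 ≤ k * p := by linarith
  have hsplit : (n : ℝ) ^ (1 + γ) = n * (n : ℝ) ^ γ := by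
    rw [Real.rpow_add hn0, Real.rpow_one]
  have hnγ : (n : ℝ) ^ γ ≤ n := by
    simpa using Real.rpow_le_rpow_of_exponent_le hn1 (hγα.trans hα1)
  have hcsq : c₀ ^ 2 ≤ c₀ := by nlinarith
  refine ⟨?_, hkpr, ((Nat.modEq_iff_dvd' hr.one_lt.le).mpr hqd).symm, ?_⟩
  · rw [hk]
    exact Nat.div_pos (Nat.le_of_dvd (by omega) hpd) hp0
  rw [hsplit]
  refine le_min (le_min ?_ ?_) ?_
  · calc c₀ ^ 2 / 2 * (n * (n : ℝ) ^ γ) ≤ 1 / 2 * (n * (n : ℝ) ^ γ) := by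
          gcongr
          linarith
      _ = (n : ℝ) ^ γ * (n / 2) := by ring
      _ ≤ p * (k * p) := by gcongr
      _ = (p : ℝ) ^ 2 * k := by ring
  · calc c₀ ^ 2 / 2 * (n * (n : ℝ) ^ γ) ≤ c₀ / 2 * (n * n) := by gcongr
      _ = n / 2 * (c₀ * n) := by ring
      _ ≤ k * p * r := by gcongr
      _ = (p : ℝ) * k * r := by ring
  · have hcγ : c₀ ≤ c₀ ^ γ := by
      simpa using Real.rpow_le_rpow_of_exponent_ge hc₀0 (by linarith) (hγα.trans hα1)
    have hqlo : c₀ * (n : ℝ) ^ γ ≤ q := by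
      calc c₀ * (n : ℝ) ^ γ ≤ c₀ ^ γ * (n : ℝ) ^ γ := by gcongr
        _ = (c₀ * n) ^ γ := (Real.mul_rpow hc₀0.le hn0.le).symm
        _ ≤ (r : ℝ) ^ γ := by gcongr
        _ ≤ (r : ℝ) ^ α := Real.rpow_le_rpow_of_exponent_le hr1 hγα
        _ ≤ q := hPr
    calc c₀ ^ 2 / 2 * (n * (n : ℝ) ^ γ) ≤ c₀ ^ 2 * (n * (n : ℝ) ^ γ) := by
          gcongr
          exact half_le_self (sq_nonneg c₀)
      _ = c₀ * (n : ℝ) ^ γ * (c₀ * n) := by ring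
      _ ≤ q * r := by gcongr
end

section
/- Let 0 < γ ≤ 1, 0 < c₀ < 1/4 and A > 0 be reals. There exists a constant C > 0 (depending only on c₀, A, γ) such that for all sufficiently large x the following holds: if R is a set of primes contained in the interval [c₀·x, x/4] with #R ≥ A·x/log x, then the set E = {n ∈ [x/2, x] : for every r ∈ R, P(n − r) ≤ n^γ} satisfies #E ≤ C · x^(max{0, 2γ−1}) · (log x)³. -/
open Finset
open scoped FourierTransform ComplexConjugate

/-- The exponential sum `∑ n ∈ s, e(nθ)`, where `e(t) = exp(2πit)`. -/
noncomputable def expSum (s : Finset ℕ) (θ : ℝ) : ℂ := ∑ n ∈ s, (𝐞 (n * θ) : ℂ)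

theorem conj_fourierChar (t : ℝ) : conj (𝐞 t : ℂ) = 𝐞 (-t) := by
  rw [AddChar.map_neg_eq_inv, Circle.coe_inv_eq_conj]

theorem fourierChar_add (s t : ℝ) : (𝐞 (s + t) : ℂ) = 𝐞 s * 𝐞 t := by
  rw [AddChar.map_add_eq_mul, Circle.coe_mul]

theorem conj_expSum (s : Finset ℕ) (θ : ℝ) : conj (expSum s θ) = expSum s (-θ) := by
  simp_rw [expSum, map_sum, conj_fourierChar, mul_neg]

theorem norm_expSum_neg (s : Finset ℕ) (θ : ℝ) : ‖expSum s (-θ)‖ = ‖expSum s θ‖ := by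
  rw [← conj_expSum, RCLike.norm_conj]

theorem norm_expSum_le_card (s : Finset ℕ) (θ : ℝ) : ‖expSum s θ‖ ≤ s.card := by
  refine (norm_sum_le _ _).trans ?_
  simp [Circle.norm_coe]

theorem norm_fourierChar_sub_one (θ : ℝ) : ‖(𝐞 θ : ℂ) - 1‖ = 2 * |Real.sin (Real.pi * θ)| := by
  rw [Real.fourierChar_apply, mul_comm _ Complex.I, Complex.norm_exp_I_mul_ofReal_sub_one]
  rw [norm_mul, Real.norm_eq_abs, Real.norm_eq_abs, abs_two]
  ring_nf

theorem fourierChar_fract (θ : ℝ) : 𝐞 (Int.fract θ) = 𝐞 θ := by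
  have h : 𝐞 (⌊θ⌋ : ℝ) = 1 := by
    ext
    rw [Real.fourierChar_apply, Circle.coe_one, Complex.exp_eq_one_iff]
    exact ⟨⌊θ⌋, by push_cast; ring⟩
  conv_rhs => rw [← Int.floor_add_fract θ, AddChar.map_add_eq_mul, h, one_mul]

theorem fourierChar_natCast_mul (n : ℕ) (θ : ℝ) : (𝐞 (n * θ) : ℂ) = (𝐞 θ : ℂ) ^ n := by
  rw [← nsmul_eq_mul, AddChar.map_nsmul_eq_pow, Circle.coe_pow]

theorem two_mul_le_abs_sin_pi_mul {t : ℝ} (h0 : 0 ≤ t) (h1 : t ≤ 1 / 2) :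
    2 * t ≤ |Real.sin (Real.pi * t)| := by
  have hpi := Real.pi_pos
  have := Real.mul_le_sin (x := Real.pi * t) (by positivity) (by nlinarith)
  refine le_trans (le_of_eq ?_) (this.trans (le_abs_self _))
  field_simp

theorem norm_expSum_range_mul_le_one (M : ℕ) (θ : ℝ) :
    ‖expSum (range M) θ‖ * (2 * min (Int.fract θ) (1 - Int.fract θ)) ≤ 1 := by
  set t := Int.fract θ
  have ht0 : 0 ≤ t := Int.fract_nonneg θ
  have ht1 : t < 1 := Int.fract_lt_one θ
  have hsin : 2 * min t (1 - t) ≤ |Real.sin (Real.pi * t)| := by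
    rcases le_total t (1 / 2) with h | h
    · rw [min_eq_left (by linarith)]
      exact two_mul_le_abs_sin_pi_mul ht0 h
    · rw [min_eq_right (by linarith)]
      have := two_mul_le_abs_sin_pi_mul (t := 1 - t) (by linarith) (by linarith)
      rwa [mul_one_sub Real.pi, Real.sin_pi_sub] at this
  have hgeom : ‖expSum (range M) θ‖ * ‖(𝐞 θ : ℂ) - 1‖ ≤ 2 := by
    rw [← norm_mul, expSum]
    simp_rw [fourierChar_natCast_mul]
    rw [geom_sum_mul]
    refine (norm_sub_le _ _).trans ?_
    rw [norm_pow, Circle.norm_coe, one_pow, norm_one, one_add_one_eq_two]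
  rw [← fourierChar_fract, norm_fourierChar_sub_one] at hgeom
  have := mul_le_mul_of_nonneg_left hsin (norm_nonneg (expSum (range M) θ))
  linarith

theorem norm_expSum_range_sq_le (M : ℕ) (θ : ℝ) :
    ‖expSum (range M) θ‖ ^ 2 ≤
      (M : ℝ) ^ 2 * ((((⌊M * Int.fract θ⌋₊ : ℕ) + 1 : ℝ) ^ 2)⁻¹ +
        (((⌊M * (1 - Int.fract θ)⌋₊ : ℕ) + 1 : ℝ) ^ 2)⁻¹) := by
  have key : ∀ t : ℝ, 0 ≤ t → ‖expSum (range M) θ‖ * (2 * t) ≤ 1 →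
      ‖expSum (range M) θ‖ ^ 2 ≤ (M : ℝ) ^ 2 * (((⌊M * t⌋₊ : ℕ) + 1 : ℝ) ^ 2)⁻¹ := by
    intro t ht h
    have hM : ‖expSum (range M) θ‖ ≤ M := by simpa using norm_expSum_le_card (range M) θ
    have hk : (⌊M * t⌋₊ : ℝ) ≤ M * t := Nat.floor_le (by positivity)
    rw [← inv_pow, ← mul_pow]
    gcongr
    rw [← div_eq_mul_inv, le_div_iff₀ (by positivity)]
    rcases Nat.eq_zero_or_pos ⌊M * t⌋₊ with h0 | h0
    · simpa [h0] using hM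
    · have h1 : (1 : ℝ) ≤ ⌊M * t⌋₊ := by exact_mod_cast h0
      calc ‖expSum (range M) θ‖ * (⌊M * t⌋₊ + 1)
          ≤ ‖expSum (range M) θ‖ * (2 * (M * t)) := by gcongr; linarith
        _ = M * (‖expSum (range M) θ‖ * (2 * t)) := by ring
        _ ≤ M * 1 := by gcongr
        _ = M := mul_one _
  have h := norm_expSum_range_mul_le_one M θ
  have ht0 : 0 ≤ Int.fract θ := Int.fract_nonneg θ
  have ht1 : 0 ≤ 1 - Int.fract θ := by linarith [Int.fract_lt_one θ]
  rw [mul_add]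
  rcases min_cases (Int.fract θ) (1 - Int.fract θ) with ⟨h', -⟩ | ⟨h', -⟩ <;> rw [h'] at h
  · exact (key _ ht0 h).trans (le_add_of_nonneg_right (by positivity))
  · exact (key _ ht1 h).trans (le_add_of_nonneg_left (by positivity))

theorem sum_inv_succ_sq_le_two (s : Finset ℕ) : ∑ k ∈ s, ((k + 1 : ℝ) ^ 2)⁻¹ ≤ 2 := by
  obtain ⟨n, hn⟩ : ∃ n, s ⊆ range n := s.exists_nat_subset_range
  calc ∑ k ∈ s, ((k + 1 : ℝ) ^ 2)⁻¹ ≤ ∑ k ∈ range n, ((k + 1 : ℝ) ^ 2)⁻¹ :=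
        sum_le_sum_of_subset_of_nonneg hn fun _ _ _ ↦ by positivity
    _ = ∑ k ∈ Ioo 0 (n + 1), ((k : ℝ) ^ 2)⁻¹ := by
        rw [show Ioo 0 (n + 1) = Ico 1 (n + 1) by ext; simp; lia, sum_Ico_eq_sum_range]
        simp [add_comm]
    _ ≤ 2 := by simpa using sum_Ioo_inv_sq_le (α := ℝ) 0 (n + 1)

section LargeSieve

variable {ι : Type*}

/-- Indexed real numbers whose pairwise distances modulo `1` are at least `1 / M`. -/
def SpacedModOne (M : ℕ) (s : Finset ι) (α : ι → ℝ) : Prop :=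
  ∀ i ∈ s, ∀ j ∈ s, i ≠ j → ∀ k : ℤ, 1 ≤ M * |α i - α j - k|

theorem SpacedModOne.eq_of_floor_eq {M : ℕ} {s : Finset ι} {α : ι → ℝ} (h : SpacedModOne M s α)
    {i j : ι} (hi : i ∈ s) (hj : j ∈ s) {x y : ℝ} (hx : 0 ≤ x) (hy : 0 ≤ y)
    (hfloor : ⌊M * x⌋₊ = ⌊M * y⌋₊) (hxy : ∃ k : ℤ, |x - y| = |α i - α j - k|) : i = j := by
  by_contra hij
  obtain ⟨k, hk⟩ := hxy
  have h1 := h i hi j hj hij k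
  rw [← hk] at h1
  have hM : (0 : ℝ) ≤ M := M.cast_nonneg
  have a1 := Nat.floor_le (mul_nonneg hM hx)
  have a2 := Nat.lt_floor_add_one ((M : ℝ) * x)
  have b1 := Nat.floor_le (mul_nonneg hM hy)
  have b2 := Nat.lt_floor_add_one ((M : ℝ) * y)
  rw [hfloor] at a1 a2
  have : |(M : ℝ) * (x - y)| < 1 := by rw [abs_lt]; constructor <;> linarith
  rw [abs_mul, abs_of_nonneg hM] at this
  linarith

theorem SpacedModOne.sum_norm_expSum_sq_le {M : ℕ} {s : Finset ι} {α : ι → ℝ}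
    (h : SpacedModOne M s α) (θ : ℝ) :
    ∑ j ∈ s, ‖expSum (range M) (θ - α j)‖ ^ 2 ≤ 4 * (M : ℝ) ^ 2 := by
  have hf0 (x : ℝ) : 0 ≤ Int.fract x := Int.fract_nonneg x
  have hf1 (x : ℝ) : 0 ≤ 1 - Int.fract x := by linarith [Int.fract_lt_one x]
  have inj1 : Set.InjOn (fun j ↦ ⌊M * Int.fract (θ - α j)⌋₊) s := fun i hi j hj hij ↦ by
    refine h.eq_of_floor_eq hi hj (hf0 _) (hf0 _) hij ⟨⌊θ - α j⌋ - ⌊θ - α i⌋, ?_⟩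
    rw [abs_sub_comm, Int.fract, Int.fract]
    push_cast
    ring_nf
  have inj2 : Set.InjOn (fun j ↦ ⌊M * (1 - Int.fract (θ - α j))⌋₊) s := fun i hi j hj hij ↦ by
    refine h.eq_of_floor_eq hi hj (hf1 _) (hf1 _) hij ⟨⌊θ - α j⌋ - ⌊θ - α i⌋, ?_⟩
    rw [Int.fract, Int.fract]
    push_cast
    ring_nf
  calc ∑ j ∈ s, ‖expSum (range M) (θ - α j)‖ ^ 2
      ≤ ∑ j ∈ s, (M : ℝ) ^ 2 * ((((⌊M * Int.fract (θ - α j)⌋₊ : ℕ) + 1 : ℝ) ^ 2)⁻¹ +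
          (((⌊M * (1 - Int.fract (θ - α j))⌋₊ : ℕ) + 1 : ℝ) ^ 2)⁻¹) :=
        sum_le_sum fun j _ ↦ norm_expSum_range_sq_le M _
    _ = (M : ℝ) ^ 2 * (∑ k ∈ s.image (fun j ↦ ⌊M * Int.fract (θ - α j)⌋₊), ((k + 1 : ℝ) ^ 2)⁻¹ +
          ∑ k ∈ s.image (fun j ↦ ⌊M * (1 - Int.fract (θ - α j))⌋₊), ((k + 1 : ℝ) ^ 2)⁻¹) := by
        rw [← mul_sum, sum_add_distrib, sum_image inj1, sum_image inj2]
    _ ≤ (M : ℝ) ^ 2 * (2 + 2) := by gcongr <;> exact sum_inv_succ_sq_le_two _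
    _ = 4 * (M : ℝ) ^ 2 := by ring

/-- The trigonometric polynomial `∑ i ∈ s, c i e(t α i)`. -/
noncomputable def dualSum (s : Finset ι) (α : ι → ℝ) (c : ι → ℂ) (t : ℝ) : ℂ :=
  ∑ i ∈ s, c i * (𝐞 (t * α i) : ℂ)

theorem sum_norm_dualSum_sub_sq (M : ℕ) (s : Finset ι) (α : ι → ℝ) (c : ι → ℂ) :
    ((∑ m ∈ range M, ∑ n ∈ range M, ‖dualSum s α c (m - n)‖ ^ 2 : ℝ) : ℂ) =
      ∑ i ∈ s, ∑ j ∈ s, c i * conj (c j) * (‖expSum (range M) (α i - α j)‖ ^ 2 : ℝ) := by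
  have hexp (i j : ι) : ((‖expSum (range M) (α i - α j)‖ ^ 2 : ℝ) : ℂ) =
      ∑ m ∈ range M, ∑ n ∈ range M, (𝐞 ((m - n) * (α i - α j)) : ℂ) := by
    push_cast
    rw [← Complex.mul_conj', conj_expSum, expSum, expSum, sum_mul_sum]
    refine sum_congr rfl fun m _ ↦ sum_congr rfl fun n _ ↦ ?_
    rw [← fourierChar_add]
    ring_nf
  have hdual (t : ℝ) : ((‖dualSum s α c t‖ ^ 2 : ℝ) : ℂ) =
      ∑ i ∈ s, ∑ j ∈ s, c i * conj (c j) * (𝐞 (t * (α i - α j)) : ℂ) := by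
    push_cast
    rw [← Complex.mul_conj', dualSum, map_sum, sum_mul_sum]
    refine sum_congr rfl fun i _ ↦ sum_congr rfl fun j _ ↦ ?_
    rw [map_mul (starRingEnd ℂ), conj_fourierChar, mul_sub, sub_eq_add_neg, fourierChar_add]
    ring
  simp_rw [Complex.ofReal_sum, hdual, hexp, mul_sum]
  simp_rw [sum_comm (s := range M) (t := s)]

theorem SpacedModOne.sum_norm_dualSum_sub_sq_le {M : ℕ} {s : Finset ι} {α : ι → ℝ}
    (h : SpacedModOne M s α) (c : ι → ℂ) :
    ∑ m ∈ range M, ∑ n ∈ range M, ‖dualSum s α c (m - n)‖ ^ 2 ≤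
      4 * (M : ℝ) ^ 2 * ∑ i ∈ s, ‖c i‖ ^ 2 := by
  set K : ι → ι → ℝ := fun i j ↦ ‖expSum (range M) (α i - α j)‖ ^ 2 with hK
  have hKsymm (i j : ι) : K i j = K j i := by
    simp only [hK]
    rw [← neg_sub (α i) (α j), norm_expSum_neg]
  have hrow : ∑ i ∈ s, ∑ j ∈ s, ‖c i‖ ^ 2 * K i j ≤ 4 * (M : ℝ) ^ 2 * ∑ i ∈ s, ‖c i‖ ^ 2 := by
    rw [mul_sum]
    refine sum_le_sum fun i _ ↦ ?_
    rw [← mul_sum, mul_comm]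
    gcongr
    exact h.sum_norm_expSum_sq_le (α i)
  have hcol : ∑ i ∈ s, ∑ j ∈ s, ‖c j‖ ^ 2 * K i j = ∑ i ∈ s, ∑ j ∈ s, ‖c i‖ ^ 2 * K i j := by
    rw [sum_comm]
    simp_rw [hKsymm]
  calc ∑ m ∈ range M, ∑ n ∈ range M, ‖dualSum s α c (m - n)‖ ^ 2
      = ‖((∑ m ∈ range M, ∑ n ∈ range M, ‖dualSum s α c (m - n)‖ ^ 2 : ℝ) : ℂ)‖ := by
        rw [Complex.norm_of_nonneg]
        positivity
    _ ≤ ∑ i ∈ s, ∑ j ∈ s, ‖c i‖ * ‖c j‖ * K i j := by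
        rw [sum_norm_dualSum_sub_sq]
        refine (norm_sum_le _ _).trans (sum_le_sum fun i _ ↦ (norm_sum_le _ _).trans
          (sum_le_sum fun j _ ↦ le_of_eq ?_))
        rw [norm_mul, norm_mul, RCLike.norm_conj, Complex.norm_of_nonneg (by positivity)]
    _ ≤ ∑ i ∈ s, ∑ j ∈ s, (‖c i‖ ^ 2 * K i j + ‖c j‖ ^ 2 * K i j) / 2 := by
        refine sum_le_sum fun i _ ↦ sum_le_sum fun j _ ↦ ?_
        have hKnn : 0 ≤ K i j := by positivity
        nlinarith [mul_nonneg (sq_nonneg (‖c i‖ - ‖c j‖)) hKnn]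
    _ = ∑ i ∈ s, ∑ j ∈ s, ‖c i‖ ^ 2 * K i j := by
        simp_rw [← sum_div, sum_add_distrib]
        rw [hcol, add_self_div_two]
    _ ≤ _ := hrow

theorem mul_sum_le_sum_range_sub {M : ℕ} (f : ℝ → ℝ) (hf : ∀ t, 0 ≤ f t) (A : Finset ℕ)
    (hA : ∀ n ∈ A, n ≤ M) :
    M * ∑ n ∈ A, f n ≤ ∑ m ∈ range (2 * M), ∑ n ∈ range (2 * M), f (m - n) := by
  calc M * ∑ n ∈ A, f n = ∑ q ∈ A ×ˢ range M, f q.1 := by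
        rw [sum_product, mul_sum]
        simp
    _ = ∑ q ∈ (A ×ˢ range M).image fun q ↦ (q.1 + q.2, q.2), f (q.1 - q.2 : ℝ) := by
        rw [sum_image]
        · simp
        · rintro ⟨a, b⟩ - ⟨c, d⟩ - h
          simp only [Prod.mk.injEq] at h ⊢
          lia
    _ ≤ ∑ q ∈ range (2 * M) ×ˢ range (2 * M), f (q.1 - q.2 : ℝ) := by
        refine sum_le_sum_of_subset_of_nonneg ?_ fun _ _ _ ↦ hf _
        intro q hq
        simp only [mem_image, mem_product, mem_range] at hq ⊢
        obtain ⟨⟨a, b⟩, ⟨ha, hb⟩, rfl⟩ := hq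
        have := hA a ha
        exact ⟨by dsimp at *; lia, by dsimp at *; lia⟩
    _ = _ := sum_product _ _ _

/-- A form of the large sieve inequality for well-spaced frequencies. -/
theorem SpacedModOne.large_sieve {M : ℕ} {s : Finset ι} {α : ι → ℝ}
    (h : SpacedModOne (2 * M) s α) (hM : 0 < M) {A : Finset ℕ} (hA : ∀ n ∈ A, n ≤ M) :
    ∑ i ∈ s, ‖expSum A (α i)‖ ^ 2 ≤ 16 * M * A.card := by
  set V := ∑ i ∈ s, ‖expSum A (α i)‖ ^ 2 with hV
  have hV0 : 0 ≤ V := by positivity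
  set c : ι → ℂ := fun i ↦ conj (expSum A (α i)) with hc
  have hM' : (0 : ℝ) < M := by exact_mod_cast hM
  have hdual : (V : ℂ) = ∑ n ∈ A, dualSum s α c n := by
    simp_rw [dualSum]
    rw [sum_comm, hV, Complex.ofReal_sum]
    refine sum_congr rfl fun i _ ↦ ?_
    rw [← mul_sum, ← expSum, hc]
    push_cast
    rw [Complex.conj_mul']
  have hVle : V ≤ ∑ n ∈ A, ‖dualSum s α c n‖ := by
    rw [← Complex.norm_of_nonneg hV0, hdual]
    exact norm_sum_le _ _
  have hcs : V ^ 2 ≤ A.card * ∑ n ∈ A, ‖dualSum s α c n‖ ^ 2 :=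
    (pow_le_pow_left₀ hV0 hVle 2).trans sq_sum_le_card_mul_sum_sq
  have hsum : M * ∑ n ∈ A, ‖dualSum s α c n‖ ^ 2 ≤ M * (16 * M * V) := by
    refine (mul_sum_le_sum_range_sub (fun t ↦ ‖dualSum s α c t‖ ^ 2) (fun _ ↦ by positivity) A
      hA).trans ((h.sum_norm_dualSum_sub_sq_le c).trans
      (le_of_eq ?_))
    simp only [hc, RCLike.norm_conj, ← hV]
    push_cast
    ring
  replace hsum := le_of_mul_le_mul_left hsum hM'
  by_contra! hlt
  have hVpos : 0 < V := lt_of_le_of_lt (by positivity) hlt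
  have : V * V ≤ V * (16 * M * A.card) := by
    nlinarith [mul_le_mul_of_nonneg_left hsum (Nat.cast_nonneg (α := ℝ) A.card)]
  exact absurd (le_of_mul_le_mul_left this hVpos) (not_le.2 hlt)

end LargeSieve

/-- The fractions `a / p` with `p ≤ N` prime and `0 < a < p` are spaced by at least `1 / N ^ 2`. -/
theorem spacedModOne_div_prime {N M : ℕ} (hNM : N ^ 2 ≤ M) {P : Finset ℕ}
    (hP : ∀ p ∈ P, p.Prime ∧ p ≤ N) :
    SpacedModOne M (P.sigma fun p ↦ Ico 1 p) fun q : (_ : ℕ) × ℕ ↦ (q.2 / q.1 : ℝ) := by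
  rintro ⟨p, a⟩ hp ⟨q, b⟩ hq hne k
  simp only [mem_sigma, mem_Ico] at hp hq
  obtain ⟨hp, ha0, hap⟩ := hp
  obtain ⟨hq, hb0, hbq⟩ := hq
  have hpp := (hP p hp).1
  have hqp := (hP q hq).1
  have hp0 : (0 : ℝ) < p := by exact_mod_cast hpp.pos
  have hq0 : (0 : ℝ) < q := by exact_mod_cast hqp.pos
  have hz : (a * q - b * p - k * (p * q) : ℤ) ≠ 0 := by
    intro h0
    rcases eq_or_ne p q with rfl | hpq
    · have hab : ((a : ℤ) - b - k * p) * p = 0 := by linear_combination h0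
      have hab' : (a : ℤ) - b = p * k := by
        rcases mul_eq_zero.1 hab with h | h
        · linear_combination h
        · exact absurd h (by exact_mod_cast hpp.ne_zero)
      have := Int.eq_zero_of_abs_lt_dvd (Dvd.intro k hab'.symm) (by rw [abs_lt]; constructor <;> lia)
      exact hne (by simp; lia)
    · have hdvd : (p : ℤ) ∣ ((a * q : ℕ) : ℤ) := ⟨b + k * q, by push_cast; linear_combination h0⟩
      rcases hpp.dvd_mul.1 (Int.natCast_dvd_natCast.1 hdvd) with h | h
      · exact absurd (Nat.le_of_dvd (by lia) h) (by lia)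
      · exact hpq ((Nat.prime_dvd_prime_iff_eq hpp hqp).1 h)
  have hz1 : (1 : ℝ) ≤ |(a * q - b * p - k * (p * q) : ℝ)| := by
    exact_mod_cast Int.one_le_abs hz
  have hM : (p * q : ℝ) ≤ M := by
    have : p * q ≤ M := (Nat.mul_le_mul (hP p hp).2 (hP q hq).2).trans (by rwa [← sq])
    exact_mod_cast this
  have heq : (a / p - b / q - k : ℝ) = (a * q - b * p - k * (p * q)) / (p * q) := by
    field_simp
  rw [heq, abs_div, abs_of_pos (mul_pos hp0 hq0), ← mul_div_assoc, le_div_iff₀ (by positivity),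
    one_mul]
  exact hM.trans (le_mul_of_one_le_right M.cast_nonneg hz1)

theorem sum_fourierChar_div_eq_zero {p : ℕ} {z : ℤ} (hp : p ≠ 0) (hz : ¬ (p : ℤ) ∣ z) :
    ∑ a ∈ range p, (𝐞 (a * (z / p)) : ℂ) = 0 := by
  have hp' : (p : ℝ) ≠ 0 := by exact_mod_cast hp
  simp_rw [fourierChar_natCast_mul]
  have hne : (𝐞 (z / p : ℝ) : ℂ) ≠ 1 := by
    rw [Real.fourierChar_apply, Ne, Complex.exp_eq_one_iff]
    rintro ⟨k, hk⟩
    refine hz ⟨k, ?_⟩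
    have h2 : ((z / p : ℝ) : ℂ) = (k : ℝ) := by
      refine mul_left_cancel₀ Complex.two_pi_I_ne_zero ?_
      push_cast at hk ⊢
      linear_combination hk
    have h3 : (z / p : ℝ) = k := by exact_mod_cast h2
    rw [div_eq_iff hp'] at h3
    rw [mul_comm]
    exact_mod_cast h3
  rw [geom_sum_eq hne, ← fourierChar_natCast_mul, mul_div_cancel₀ _ hp']
  have : (𝐞 (z : ℝ) : ℂ) = 1 := by
    rw [Real.fourierChar_apply, Complex.exp_eq_one_iff]
    exact ⟨z, by push_cast; ring⟩
  rw [this, sub_self, zero_div]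

theorem sum_expSum_mul_conj_expSum {p : ℕ} (hp : p ≠ 0) {A B : Finset ℕ}
    (h : ∀ n ∈ A, ∀ r ∈ B, ¬ (p : ℤ) ∣ n - r) :
    ∑ a ∈ Ico 1 p, expSum A (a / p) * conj (expSum B (a / p)) = -(A.card * B.card : ℂ) := by
  have h0 : ∑ a ∈ range p, expSum A (a / p) * conj (expSum B (a / p)) = 0 := by
    simp_rw [conj_expSum, expSum, sum_mul_sum]
    rw [sum_comm]
    refine sum_eq_zero fun n hn ↦ ?_
    rw [sum_comm]
    refine sum_eq_zero fun r hr ↦ ?_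
    rw [← sum_fourierChar_div_eq_zero hp (h n hn r hr)]
    refine sum_congr rfl fun a _ ↦ ?_
    rw [← fourierChar_add]
    push_cast
    ring_nf
  rw [range_eq_Ico, sum_eq_sum_Ico_succ_bot (Nat.pos_of_ne_zero hp)] at h0
  have hcard (s : Finset ℕ) : expSum s 0 = s.card := by
    simp [expSum]
  simp only [Nat.cast_zero, zero_div, hcard, map_natCast, zero_add] at h0
  linear_combination h0

/-- If no prime of `P` divides a difference of an element of `A` and an element of `B`, then the
large sieve bounds `#A * #B`. -/
theorem card_mul_card_le_of_forall_not_dvd_sub {N M : ℕ} (hM : 0 < M) (hNM : N ^ 2 ≤ 2 * M)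
    {P A B : Finset ℕ} (hP : ∀ p ∈ P, p.Prime ∧ p ≤ N) (hA : ∀ n ∈ A, n ≤ M)
    (hB : ∀ r ∈ B, r ≤ M) (h : ∀ p ∈ P, ∀ n ∈ A, ∀ r ∈ B, ¬ (p : ℤ) ∣ n - r) :
    (P.card : ℝ) ^ 2 * (A.card * B.card) ≤ (16 * M) ^ 2 := by
  set s := P.sigma fun p ↦ Ico 1 p
  have hs := spacedModOne_div_prime hNM hP
  have hle : P.card * (A.card * B.card : ℝ) ≤
      ∑ q ∈ s, ‖expSum A (q.2 / q.1)‖ * ‖expSum B (q.2 / q.1)‖ := by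
    rw [sum_sigma, ← nsmul_eq_mul, ← sum_const]
    refine sum_le_sum fun p hp ↦ ?_
    have := norm_sum_le (Ico 1 p) fun a ↦ expSum A (a / p) * conj (expSum B (a / p))
    rw [sum_expSum_mul_conj_expSum (hP p hp).1.ne_zero (h p hp)] at this
    simpa using this
  have hcs := (pow_le_pow_left₀ (by positivity) hle 2).trans (sum_mul_sq_le_sq_mul_sq s _ _)
  have hmul := hcs.trans (mul_le_mul (hs.large_sieve hM hA) (hs.large_sieve hM hB)
    (by positivity) (by positivity))
  rcases (by positivity : (0 : ℝ) ≤ A.card * B.card).eq_or_lt with h0 | h0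
  · rw [← h0, mul_zero]
    positivity
  · refine le_of_mul_le_mul_right (hmul.trans_eq' ?_ |>.trans_eq ?_) h0 <;> ring

theorem isLittleO_sqrt_mul_log_id :
    (fun u : ℝ ↦ √u * Real.log u) =o[Filter.atTop] fun u ↦ u := by
  refine ((Asymptotics.isBigO_refl Real.sqrt Filter.atTop).mul_isLittleO
    (isLittleO_log_rpow_atTop (show (0 : ℝ) < 1 / 2 by norm_num))).congr' .rfl ?_
  filter_upwards [Filter.eventually_ge_atTop 0] with u hu
  rw [← Real.sqrt_eq_rpow, Real.mul_self_sqrt hu]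

theorem eventually_log_add_two_mul_sqrt_mul_log_le :
    ∀ᶠ Q : ℕ in Filter.atTop,
      Real.log (4 * Q + 1) + 2 * √(4 * Q) * Real.log (4 * Q) ≤ Q / 4 := by
  have htendsto : Filter.Tendsto (fun Q : ℕ ↦ (4 * Q + 1 : ℝ)) Filter.atTop Filter.atTop :=
    Filter.tendsto_atTop_add_const_right _ _
      (tendsto_natCast_atTop_atTop.const_mul_atTop (by norm_num))
  have hbound := htendsto.eventually
    (isLittleO_sqrt_mul_log_id.bound (show (0 : ℝ) < 1 / 60 by norm_num))
  filter_upwards [hbound, Filter.eventually_ge_atTop 1] with Q hQ hQ1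
  have hQ1' : (1 : ℝ) ≤ Q := by exact_mod_cast hQ1
  set u : ℝ := 4 * Q + 1 with hu
  have hu0 : 0 < u := by positivity
  rw [Real.norm_eq_abs, Real.norm_eq_abs, abs_of_pos hu0] at hQ
  replace hQ := (le_abs_self _).trans hQ
  have hlogu : 0 ≤ Real.log u := Real.log_nonneg (by linarith)
  have hlog : Real.log (4 * Q) ≤ Real.log u := Real.log_le_log (by positivity) (by linarith)
  have hsqrt : √(4 * Q : ℝ) ≤ √u := Real.sqrt_le_sqrt (by linarith)
  have hsqrt1 : 1 ≤ √u := Real.one_le_sqrt.2 (by linarith)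
  have h1 : √(4 * Q : ℝ) * Real.log (4 * Q) ≤ √u * Real.log u :=
    mul_le_mul hsqrt hlog (Real.log_nonneg (by linarith)) (by positivity)
  have h2 : Real.log u ≤ √u * Real.log u := le_mul_of_one_le_left hlogu hsqrt1
  linarith

theorem eventually_le_card_primes_mul_log :
    ∀ᶠ Q : ℕ in Filter.atTop,
      (Q : ℝ) ≤ ((Ioc Q (4 * Q)).filter Nat.Prime).card * Real.log (4 * Q) := by
  filter_upwards [eventually_log_add_two_mul_sqrt_mul_log_le, Filter.eventually_gt_atTop 0]
    with Q hQ hQ0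
  have h1 := Chebyshev.theta_ge (4 * Q)
  have h2 := Chebyshev.theta_le_log4_mul_x (x := Q) Q.cast_nonneg
  have hlog4 : Real.log 4 = 2 * Real.log 2 := by
    rw [show (4 : ℝ) = 2 ^ 2 by norm_num, Real.log_pow]
    norm_num
  have hlog2 := Real.log_two_gt_d9
  have hQ' : (0 : ℝ) < Q := by exact_mod_cast hQ0
  have h3 : Chebyshev.theta (4 * Q : ℕ) - Chebyshev.theta Q =
      ∑ p ∈ (Ioc Q (4 * Q)).filter Nat.Prime, Real.log p := by
    rw [Chebyshev.theta, Chebyshev.theta, Nat.floor_natCast, Nat.floor_natCast, sub_eq_iff_eq_add,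
      ← Ioc_union_Ioc_eq_Ioc (Nat.zero_le Q) (by lia : Q ≤ 4 * Q), filter_union, sum_union, add_comm]
    exact disjoint_filter_filter (Ioc_disjoint_Ioc_of_le le_rfl)
  have h4 : ∑ p ∈ (Ioc Q (4 * Q)).filter Nat.Prime, Real.log p ≤
      ((Ioc Q (4 * Q)).filter Nat.Prime).card * Real.log (4 * Q) := by
    rw [← nsmul_eq_mul]
    refine sum_le_card_nsmul _ _ _ fun p hp ↦ ?_
    simp only [mem_filter, mem_Ioc] at hp
    exact Real.log_le_log (by exact_mod_cast hp.2.pos) (by exact_mod_cast hp.1.2)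
  push_cast at *
  nlinarith

theorem Nat.Prime.le_maxPrimeFac {p k : ℕ} (hp : p.Prime) (hk : k ≠ 0) (h : p ∣ k) :
    p ≤ maxPrimeFac k :=
  Finset.le_sup (f := id) (Nat.mem_primeFactors.2 ⟨hp, h, hk⟩)

/-- Let `0 < γ ≤ 1`, `0 < c₀ < 1/4` and `A > 0` be reals. There exists
`C > 0` such that for all sufficiently large `x`: if `R` is a set of primes in
`[c₀·x, x/4]` with `#R ≥ A·x/log x`, then
`E = {n ∈ [x/2, x] : ∀ r ∈ R, P(n − r) ≤ n^γ}` satisfies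
`#E ≤ C·x^(max{0, 2γ−1})·(log x)³`. -/
theorem exceptional_set_bound (γ c₀ A : ℝ) (hγ0 : 0 < γ) (hγ1 : γ ≤ 1)
    (hc₀0 : 0 < c₀) (hc₀1 : c₀ < 1 / 4) (hA : 0 < A) :
    ∃ C : ℝ, 0 < C ∧ ∃ x₀ : ℝ, ∀ x : ℝ, x₀ ≤ x →
      ∀ R : Finset ℕ,
        (∀ r ∈ R, Nat.Prime r ∧ c₀ * x ≤ (r : ℝ) ∧ (r : ℝ) ≤ x / 4) →
        A * x / Real.log x ≤ (R.card : ℝ) →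
        (Set.ncard {n : ℕ | x / 2 ≤ (n : ℝ) ∧ (n : ℝ) ≤ x ∧
            ∀ r ∈ R, (maxPrimeFac (n - r) : ℝ) ≤ (n : ℝ) ^ γ} : ℝ) ≤
          C * x ^ (max 0 (2 * γ - 1)) * Real.log x ^ 3 := by
  obtain ⟨Q₀, hQ₀⟩ := Filter.eventually_atTop.1 eventually_le_card_primes_mul_log
  refine ⟨2 ^ 18 / A, by positivity, max 8 ((Q₀ : ℝ) ^ 2), fun x hx R hR hRcard ↦ ?_⟩
  have hx8 : 8 ≤ x := (le_max_left _ _).trans hx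
  have hx0 : 0 < x := by linarith
  have hxQ₀ : (Q₀ : ℝ) ^ 2 ≤ x := (le_max_right _ _).trans hx
  have hlogx : 0 < Real.log x := Real.log_pos (by linarith)
  set y : ℝ := x ^ max (1 / 2) γ with hy
  have hyγ : x ^ γ ≤ y := Real.rpow_le_rpow_of_exponent_le (by linarith) (le_max_right _ _)
  have hy2 : y ^ 2 = x * x ^ max 0 (2 * γ - 1) := by
    rw [← Real.rpow_natCast, hy, ← Real.rpow_mul hx0.le, ← Real.rpow_one_add' hx0.le (by positivity)]
    congr 1
    rcases max_cases (1 / 2) γ with h | h <;> rcases max_cases 0 (2 * γ - 1) with h' | h' <;>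
      push_cast <;> linarith
  have hxy : x ≤ y ^ 2 := by
    rw [hy2]
    exact le_mul_of_one_le_right hx0.le (Real.one_le_rpow (by linarith) (le_max_left _ _))
  have hyx : y ≤ x := by
    conv_rhs => rw [← Real.rpow_one x]
    exact Real.rpow_le_rpow_of_exponent_le (by linarith) (max_le (by norm_num) hγ1)
  have hy1 : 1 ≤ y := Real.one_le_rpow (by linarith) (by positivity)
  set Q : ℕ := ⌈y⌉₊ with hQ
  have hyQ : y ≤ Q := Nat.le_ceil y
  have hQy : (Q : ℝ) ≤ 2 * y := by linarith [Nat.ceil_lt_add_one (by linarith : 0 ≤ y)]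
  have hQ1 : (1 : ℝ) ≤ Q := hy1.trans hyQ
  have hxQ : x ≤ (Q : ℝ) ^ 2 := hxy.trans (by gcongr)
  have hQQ₀ : Q₀ ≤ Q := by
    have := le_of_sq_le_sq (hxQ₀.trans hxQ) (by positivity)
    exact_mod_cast this
  have hlogQ : Real.log (4 * Q) ≤ 2 * Real.log x := by
    rw [← Nat.cast_two (R := ℝ), ← Real.log_pow]
    exact Real.log_le_log (by positivity) (by nlinarith)
  set P := (Ioc Q (4 * Q)).filter Nat.Prime
  have hPcard : (Q : ℝ) ≤ P.card * (2 * Real.log x) :=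
    (hQ₀ Q hQQ₀).trans (by gcongr)
  set E : Set ℕ := {n : ℕ | x / 2 ≤ (n : ℝ) ∧ (n : ℝ) ≤ x ∧
    ∀ r ∈ R, (maxPrimeFac (n - r) : ℝ) ≤ (n : ℝ) ^ γ} with hE
  have hEfin : E.Finite :=
    (Set.finite_Iic ⌊x⌋₊).subset fun n hn ↦ Nat.le_floor hn.2.1
  rw [Set.ncard_eq_toFinset_card E hEfin]
  set F := hEfin.toFinset
  have hF (n : ℕ) (hn : n ∈ F) : n ∈ E := hEfin.mem_toFinset.1 hn
  have hle8 (n : ℕ) (hn : (n : ℝ) ≤ x) : n ≤ 8 * Q ^ 2 := by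
    have : (n : ℝ) ≤ 8 * (Q : ℝ) ^ 2 := by nlinarith
    exact_mod_cast this
  have hsieve : (P.card : ℝ) ^ 2 * (F.card * R.card) ≤ (16 * (8 * Q ^ 2 : ℕ)) ^ 2 := by
    have hQpos : 0 < Q := by exact_mod_cast hQ1
    refine card_mul_card_le_of_forall_not_dvd_sub (N := 4 * Q) (by positivity) (by lia) ?_
      (fun n hn ↦ hle8 n (hF n hn).2.1) (fun r hr ↦ hle8 r (by linarith [(hR r hr).2.2])) ?_
    · intro p hp
      simp only [P, mem_filter, mem_Ioc] at hp
      exact ⟨hp.2, hp.1.2⟩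
    · intro p hp n hn r hr hdvd
      simp only [P, mem_filter, mem_Ioc] at hp
      obtain ⟨hn1, hn2, hn3⟩ := hF n hn
      have hrn : r < n := by
        have : (r : ℝ) < n := by linarith [(hR r hr).2.2]
        exact_mod_cast this
      rw [← Nat.cast_sub hrn.le, Int.natCast_dvd_natCast] at hdvd
      have h1 : (p : ℝ) ≤ maxPrimeFac (n - r) := by
        exact_mod_cast hp.2.le_maxPrimeFac (by lia) hdvd
      have h2 : (n : ℝ) ^ γ ≤ x ^ γ := by gcongr
      have h3 : (Q : ℝ) < p := by exact_mod_cast hp.1.1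
      linarith [hn3 r hr]
  have hQ0 : (0 : ℝ) < (Q : ℝ) ^ 2 := by positivity
  have hFR : (F.card * R.card : ℝ) ≤ 2 ^ 16 * Q ^ 2 * Real.log x ^ 2 := by
    refine le_of_mul_le_mul_left ?_ hQ0
    calc (Q : ℝ) ^ 2 * (F.card * R.card)
        ≤ (P.card * (2 * Real.log x)) ^ 2 * (F.card * R.card) := by gcongr
      _ = (P.card ^ 2 * (F.card * R.card)) * (4 * Real.log x ^ 2) := by ring
      _ ≤ (16 * (8 * Q ^ 2 : ℕ)) ^ 2 * (4 * Real.log x ^ 2) := by gcongr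
      _ = (Q : ℝ) ^ 2 * (2 ^ 16 * Q ^ 2 * Real.log x ^ 2) := by push_cast; ring
  have hpos : 0 < A * x / Real.log x := by positivity
  refine le_of_mul_le_mul_right ?_ hpos
  calc (F.card : ℝ) * (A * x / Real.log x) ≤ F.card * R.card := by gcongr
    _ ≤ 2 ^ 16 * Q ^ 2 * Real.log x ^ 2 := hFR
    _ ≤ 2 ^ 16 * (2 * y) ^ 2 * Real.log x ^ 2 := by gcongr
    _ = 2 ^ 18 * (x * x ^ max 0 (2 * γ - 1)) * Real.log x ^ 2 := by rw [← hy2]; ring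
    _ = _ := by field_simp
end
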